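/- Let m n : ℕ, let x : ℝ → ℂ be m-times differentiable and y : ℝ → ℂ be n-times differentiable on [0, ∞) with iterated derivatives x^(k), y^(k), let s : ℂ, suppose for each k ≤ m (resp. k ≤ n) the function x^(k) (resp. y^(k)) is of exponential order (M_k, a_k) for some M_k > 0 and a_k with Re s > a_k and its Laplace transform exists at s, suppose x^(k)(0) = 0 for k < m and y^(k)(0) = 0 for k < n (zero initial conditions), let α : Fin (n+1) → ℂ and β : Fin (m+1) → ℂ satisfy the differential equation ∑_{k=0}^{n} α k * y^(k)(t) = ∑_{k=0}^{m} β k * x^(k)(t) for all t ≥ 0, and suppose L[x](s) ≠ 0 and ∑_{k=0}^{n} α k * s^k ≠ 0. Then L[y](s) / L[x](s) = (∑_{k=0}^{m} β k * s^k) / (∑_{k=0}^{n} α k * s^k) (transfer function of a generic n-th order linear system). -/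

import Mathlib

open MeasureTheory Set

/-- The Laplace transform of `f : ℝ → ℂ` at `s : ℂ`. -/
noncomputable def laplace (f : ℝ → ℂ) (s : ℂ) : ℂ :=
  ∫ t in Set.Ioi (0 : ℝ), Complex.exp (-(s * t)) * f t

/-- The Laplace transform of `f` exists at `s`. -/
def laplaceExists (f : ℝ → ℂ) (s : ℂ) : Prop :=
  MeasureTheory.IntegrableOn (fun t : ℝ => Complex.exp (-(s * t)) * f t) (Set.Ioi (0 : ℝ))

/-- `f` is of exponential order `(M, a)`. -/
def expOrder (f : ℝ → ℂ) (M a : ℝ) : Prop :=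
  0 < M ∧ ∀ t : ℝ, 0 ≤ t → ‖f t‖ ≤ M * Real.exp (a * t)

/-- A function of exponential order `(M, a)` is killed at infinity by `exp (-s t)` when
`a < Re s`. -/
lemma expOrder.tendsto_exp_mul {f : ℝ → ℂ} {M a : ℝ} (hf : expOrder f M a) {s : ℂ}
    (ha : a < s.re) :
    Filter.Tendsto (fun t : ℝ => Complex.exp (-(s * t)) * f t) Filter.atTop (nhds 0) := by
  have hlim : Filter.Tendsto (fun t : ℝ => M * Real.exp (-((s.re - a) * t)))
      Filter.atTop (nhds 0) := by
    simpa using (Real.tendsto_exp_neg_atTop_nhds_zero.comp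
      (Filter.tendsto_id.const_mul_atTop (sub_pos.2 ha))).const_mul M
  refine squeeze_zero_norm' ?_ hlim
  filter_upwards [Filter.eventually_ge_atTop 0] with t ht
  calc ‖Complex.exp (-(s * t)) * f t‖
      ≤ Real.exp (-(s.re * t)) * (M * Real.exp (a * t)) := by
        rw [norm_mul, Complex.norm_exp]
        simpa using mul_le_mul_of_nonneg_left (hf.2 t ht) (Real.exp_pos (-(s.re * t))).le
    _ = M * Real.exp (-((s.re - a) * t)) := by
        rw [mul_left_comm, ← Real.exp_add]
        ring_nf

/-- The Laplace transform of a derivative. -/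
lemma laplace_deriv {f : ℝ → ℂ} {s : ℂ} {M a : ℝ}
    (hdiff : ∀ t ∈ Set.Ici (0 : ℝ), DifferentiableAt ℝ f t)
    (hf : expOrder f M a) (ha : a < s.re)
    (hlap : laplaceExists f s) (hlap' : laplaceExists (deriv f) s) :
    laplace (deriv f) s = s * laplace f s - f 0 := by
  have hderiv : ∀ t ∈ Set.Ici (0 : ℝ), HasDerivAt (fun t : ℝ => Complex.exp (-(s * t)) * f t)
      (Complex.exp (-(s * t)) * deriv f t - s * (Complex.exp (-(s * t)) * f t)) t := by
    intro t ht
    have hlin : HasDerivAt (fun t : ℝ => -(s * (t : ℂ))) (-(s * 1)) t :=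
      ((Complex.ofRealCLM.hasDerivAt (x := t)).const_mul s).neg
    exact (hlin.cexp.mul (hdiff t ht).hasDerivAt).congr_deriv (by ring)
  have hint := integral_Ioi_of_hasDerivAt_of_tendsto' hderiv
    (hlap'.sub (hlap.const_mul s)) (hf.tendsto_exp_mul ha)
  rw [integral_sub hlap' (hlap.const_mul s), integral_const_mul] at hint
  simp only [Complex.ofReal_zero, mul_zero, neg_zero, Complex.exp_zero, one_mul, zero_sub] at hint
  rw [laplace, laplace]
  linear_combination hint

/-- The Laplace transform of iterated derivatives under zero initial conditions. -/
lemma laplace_iterate_deriv {f : ℝ → ℂ} {s : ℂ} {n : ℕ}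
    (hdiff : ∀ k < n, ∀ t ∈ Set.Ici (0 : ℝ), DifferentiableAt ℝ (deriv^[k] f) t)
    (hexp : ∀ k ≤ n, ∃ M a : ℝ, a < s.re ∧ expOrder (deriv^[k] f) M a)
    (hlap : ∀ k ≤ n, laplaceExists (deriv^[k] f) s)
    (hzero : ∀ k < n, deriv^[k] f 0 = 0) :
    ∀ k ≤ n, laplace (deriv^[k] f) s = s ^ k * laplace f s := by
  intro k
  induction k with
  | zero => simp
  | succ k ih =>
    intro hk
    obtain ⟨M, a, ha, hf⟩ := hexp k (by omega)
    have hlap' := hlap (k + 1) hk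
    rw [Function.iterate_succ_apply'] at hlap' ⊢
    rw [laplace_deriv (hdiff k hk) hf ha (hlap k (by omega)) hlap', ih (by omega), hzero k hk]
    ring

/-- The Laplace transform of a linear differential operator with constant coefficients, under
zero initial conditions. -/
lemma laplace_sum_iterate_deriv {f : ℝ → ℂ} {s : ℂ} {n : ℕ} (c : Fin (n + 1) → ℂ)
    (hdiff : ∀ k < n, ∀ t ∈ Set.Ici (0 : ℝ), DifferentiableAt ℝ (deriv^[k] f) t)
    (hexp : ∀ k ≤ n, ∃ M a : ℝ, a < s.re ∧ expOrder (deriv^[k] f) M a)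
    (hlap : ∀ k ≤ n, laplaceExists (deriv^[k] f) s)
    (hzero : ∀ k < n, deriv^[k] f 0 = 0) :
    laplace (fun t => ∑ k : Fin (n + 1), c k * deriv^[(k : ℕ)] f t) s =
      (∑ k : Fin (n + 1), c k * s ^ (k : ℕ)) * laplace f s := by
  have hk (k : Fin (n + 1)) : (k : ℕ) ≤ n := Nat.lt_succ_iff.1 k.2
  rw [laplace]
  simp_rw [Finset.mul_sum, mul_left_comm (Complex.exp _)]
  rw [integral_finsetSum _ fun (k : Fin (n + 1)) _ => (hlap (k : ℕ) (hk k)).const_mul (c k), Finset.sum_mul]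
  refine Finset.sum_congr rfl fun k _ => ?_
  rw [integral_const_mul, mul_assoc, ← laplace_iterate_deriv hdiff hexp hlap hzero k (hk k),
    laplace]

/-- Transfer function of a generic n-th order linear system. -/
theorem transfer_function_n_order_system (m n : ℕ) (x y : ℝ → ℂ) (s : ℂ)
    (α : Fin (n + 1) → ℂ) (β : Fin (m + 1) → ℂ)
    (hxdiff : ∀ k < m, ∀ t ∈ Set.Ici (0 : ℝ), DifferentiableAt ℝ (deriv^[k] x) t)
    (hydiff : ∀ k < n, ∀ t ∈ Set.Ici (0 : ℝ), DifferentiableAt ℝ (deriv^[k] y) t)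
    (hxexp : ∀ k ≤ m, ∃ M a : ℝ, a < s.re ∧ expOrder (deriv^[k] x) M a)
    (hyexp : ∀ k ≤ n, ∃ M a : ℝ, a < s.re ∧ expOrder (deriv^[k] y) M a)
    (hxlap : ∀ k ≤ m, laplaceExists (deriv^[k] x) s)
    (hylap : ∀ k ≤ n, laplaceExists (deriv^[k] y) s)
    (hxzero : ∀ k < m, deriv^[k] x 0 = 0)
    (hyzero : ∀ k < n, deriv^[k] y 0 = 0)
    (hdiffeq : ∀ t : ℝ, 0 ≤ t →
      ∑ k : Fin (n + 1), α k * deriv^[(k : ℕ)] y t =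
        ∑ k : Fin (m + 1), β k * deriv^[(k : ℕ)] x t)
    (hx0 : laplace x s ≠ 0)
    (hden : ∑ k : Fin (n + 1), α k * s ^ (k : ℕ) ≠ 0) :
    laplace y s / laplace x s =
      (∑ k : Fin (m + 1), β k * s ^ (k : ℕ)) / (∑ k : Fin (n + 1), α k * s ^ (k : ℕ)) := by
  rw [div_eq_div_iff hx0 hden, mul_comm,
    ← laplace_sum_iterate_deriv α hydiff hyexp hylap hyzero,
    ← laplace_sum_iterate_deriv β hxdiff hxexp hxlap hxzero]
  exact setIntegral_congr_fun measurableSet_Ioi fun t ht =>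
    congrArg (Complex.exp (-(s * t)) * ·) (hdiffeq t (le_of_lt ht))
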